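/- Let 0<q<1, let n≥3 be an integer, let 1≤i≤n, and let t be an integer with 1 ≤ t ≤ (n+5)/8. If π is distributed according to the (n,q)-Mallows measure, then P(|π(i) − i| ≥ t) ≥ (1/2)·q^{2t−1}. -/

import Mathlib

open Finset

/-- Number of inversions of a permutation of `Fin n`. -/
def mallowsInv {n : ℕ} (π : Equiv.Perm (Fin n)) : ℕ :=
  (Finset.univ.filter (fun p : Fin n × Fin n => p.1 < p.2 ∧ π p.2 < π p.1)).card

/-- The `(n,q)`-Mallows probability mass function on `S_n`. -/
noncomputable def mallowsPMF (n : ℕ) (q : ℝ) (π : Equiv.Perm (Fin n)) : ℝ :=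
  q ^ mallowsInv π / ∑ σ : Equiv.Perm (Fin n), q ^ mallowsInv σ

/-- Probability of an event under the `(n,q)`-Mallows measure. -/
noncomputable def mallowsProb (n : ℕ) (q : ℝ) (A : Set (Equiv.Perm (Fin n))) : ℝ :=
  ∑ π : Equiv.Perm (Fin n), A.indicator (mallowsPMF n q) π

/-- Expectation of a function under the `(n,q)`-Mallows measure. -/
noncomputable def mallowsExp (n : ℕ) (q : ℝ) (f : Equiv.Perm (Fin n) → ℝ) : ℝ :=
  ∑ π : Equiv.Perm (Fin n), mallowsPMF n q π * f π

/-- Length of the longest increasing subsequence of a permutation of `Fin n`. -/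
noncomputable def LIS {n : ℕ} (π : Equiv.Perm (Fin n)) : ℕ :=
  sSup {m | ∃ f : Fin m → Fin n, StrictMono f ∧ StrictMono (fun j => π (f j))}

/-- Length of the longest decreasing subsequence of a permutation of `Fin n`. -/
noncomputable def LDS {n : ℕ} (π : Equiv.Perm (Fin n)) : ℕ :=
  sSup {m | ∃ f : Fin m → Fin n, StrictMono f ∧ StrictAnti (fun j => π (f j))}

/-- Exchanging two adjacent values creates at most one new inversion. -/
theorem mallowsInv_swap_mul_le {n : ℕ} (a b : Fin n) (hab : (b : ℕ) = a + 1)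
    (π : Equiv.Perm (Fin n)) : mallowsInv (Equiv.swap a b * π) ≤ mallowsInv π + 1 := by
  unfold mallowsInv
  refine (Finset.card_le_card fun p hp => ?_).trans (Finset.card_insert_le (π.symm a, π.symm b) _)
  obtain ⟨x, y⟩ := p
  obtain ⟨-, hlt, hinv⟩ := Finset.mem_filter.1 hp
  simp only [Finset.mem_filter, Finset.mem_univ, true_and, Finset.mem_insert, Prod.mk.injEq]
  simp only [Equiv.Perm.mul_apply] at hlt hinv
  by_cases h : π y < π x
  · exact Or.inr ⟨hlt, h⟩
  · left
    have hne : π x ≠ π y := fun e => hlt.ne (π.injective e)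
    rw [Equiv.eq_symm_apply, Equiv.eq_symm_apply]
    simp only [Equiv.swap_apply_def] at hinv
    split_ifs at hinv <;> simp only [Fin.ext_iff, Fin.lt_def, ne_eq] at * <;> omega

/-- The value `a` can be moved up to `a + m`, and back, creating at most `m` inversions. -/
theorem exists_perm_move_up {n : ℕ} (m : ℕ) (a b : Fin n) (hab : (b : ℕ) = a + m) :
    ∃ c : Equiv.Perm (Fin n), c a = b ∧
      (∀ π, mallowsInv (c * π) ≤ mallowsInv π + m) ∧
      ∀ π, mallowsInv (c⁻¹ * π) ≤ mallowsInv π + m := by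
  induction m generalizing b with
  | zero => exact ⟨1, by simpa [Fin.ext_iff] using hab.symm, by simp, by simp⟩
  | succ m ih =>
    have hb := b.isLt
    obtain ⟨c, hc, hup, hdown⟩ := ih ⟨a + m, by omega⟩ rfl
    have hstep := mallowsInv_swap_mul_le ⟨a + m, by omega⟩ b (by simp only; omega)
    refine ⟨Equiv.swap ⟨a + m, by omega⟩ b * c, by simp [hc], fun π => ?_, fun π => ?_⟩
    · rw [mul_assoc]
      have h₁ := hstep (c * π)
      have h₂ := hup π
      omega
    · rw [mul_inv_rev, Equiv.swap_inv, mul_assoc]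
      have h₁ := hdown (Equiv.swap ⟨a + m, by omega⟩ b * π)
      have h₂ := hstep π
      omega

/-- Any value `a` can be moved to `b` by a permutation of the values which creates at most
`m = |b - a|` inversions. -/
theorem exists_perm_move {n : ℕ} (m : ℕ) (a b : Fin n)
    (hab : (b : ℕ) = a + m ∨ (a : ℕ) = b + m) :
    ∃ c : Equiv.Perm (Fin n), c a = b ∧ ∀ π, mallowsInv (c * π) ≤ mallowsInv π + m := by
  rcases hab with h | h
  · obtain ⟨c, hc, hup, -⟩ := exists_perm_move_up m a b h
    exact ⟨c, hc, hup⟩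
  · obtain ⟨c, hc, -, hdown⟩ := exists_perm_move_up m b a h
    exact ⟨c⁻¹, by simp [← hc], hdown⟩

/-- Injectively moving the values in `B` out of `B`, each by `m`, compares the weight of
`{π | π i ∈ B}` with that of its complement. -/
theorem pow_mul_sum_le_sum_of_move {n : ℕ} {q : ℝ} (hq0 : 0 < q) (hq1 : q < 1) (i : Fin n)
    (m : ℕ) (B : Fin n → Prop) [DecidablePred B] (T : ∀ v, B v → Fin n)
    (hT : ∀ v hv, (T v hv : ℕ) = v + m ∨ (v : ℕ) = T v hv + m)
    (hB : ∀ v hv, ¬ B (T v hv))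
    (hinj : ∀ v hv w hw, T v hv = T w hw → v = w) :
    q ^ m * ∑ π : Equiv.Perm (Fin n) with B (π i), q ^ mallowsInv π
      ≤ ∑ π : Equiv.Perm (Fin n) with ¬ B (π i), q ^ mallowsInv π := by
  have hmove : ∀ v, ∃ c : Equiv.Perm (Fin n), ∀ hv : B v,
      c v = T v hv ∧ ∀ π, mallowsInv (c * π) ≤ mallowsInv π + m := fun v => by
    by_cases hv : B v
    · obtain ⟨c, hc⟩ := exists_perm_move m v (T v hv) (hT v hv)
      exact ⟨c, fun _ => hc⟩
    · exact ⟨1, fun h => absurd h hv⟩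
  choose c hc using hmove
  have hcinj : Set.InjOn (fun π : Equiv.Perm (Fin n) => c (π i) * π)
      (Finset.univ.filter fun π : Equiv.Perm (Fin n) => B (π i)) := by
    intro π hπ σ hσ h
    simp only [Finset.coe_filter, Finset.mem_univ, true_and, Set.mem_ofPred_eq] at hπ hσ
    simp only at h
    have hi : π i = σ i := by
      refine hinj _ hπ _ hσ ?_
      rw [← (hc _ hπ).1, ← (hc _ hσ).1]
      exact DFunLike.congr_fun h i
    rw [hi] at h
    exact mul_left_cancel h
  calc _ ≤ ∑ π : Equiv.Perm (Fin n) with B (π i), q ^ mallowsInv (c (π i) * π) := by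
        rw [Finset.mul_sum]
        refine Finset.sum_le_sum fun π hπ => ?_
        rw [← pow_add]
        refine pow_le_pow_of_le_one hq0.le hq1.le ?_
        rw [add_comm m]
        exact (hc _ (Finset.mem_filter.1 hπ).2).2 π
    _ = ∑ π ∈ (Finset.univ.filter fun π : Equiv.Perm (Fin n) => B (π i)).image
          (fun π => c (π i) * π), q ^ mallowsInv π :=
        (Finset.sum_image (f := fun π => q ^ mallowsInv π) hcinj).symm
    _ ≤ _ := by
        refine Finset.sum_le_sum_of_subset_of_nonneg (fun σ hσ => ?_)
          fun _ _ _ => pow_nonneg hq0.le _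
        obtain ⟨π, hπ, rfl⟩ := Finset.mem_image.1 hσ
        have hb := (Finset.mem_filter.1 hπ).2
        simpa [(hc _ hb).1] using hB _ hb

/-- For `0<q<1`, `n≥3`, `1≤i≤n` and integer `1 ≤ t ≤ (n+5)/8`, if `π ~ μ_{n,q}`
then `P(|π(i) − i| ≥ t) ≥ (1/2)·q^{2t−1}`. -/
theorem mallows_displacement_tail_lower (n : ℕ) (hn : 3 ≤ n) (q : ℝ)
    (hq0 : 0 < q) (hq1 : q < 1) (i : Fin n) (t : ℕ) (ht1 : 1 ≤ t)
    (ht2 : (t : ℝ) ≤ ((n : ℝ) + 5) / 8) :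
    (1 / 2) * q ^ (2 * t - 1) ≤ mallowsProb n q {π | (t : ℤ) ≤ |(π i : ℤ) - (i : ℤ)|} := by
  have htn : 8 * t ≤ n + 5 := by
    have h : (8 : ℝ) * t ≤ n + 5 := by linarith
    exact_mod_cast h
  have hin := i.isLt
  have hcomp : q ^ (2 * t - 1) *
      ∑ π : Equiv.Perm (Fin n) with |(π i : ℤ) - (i : ℤ)| < t, q ^ mallowsInv π
      ≤ ∑ π : Equiv.Perm (Fin n) with ¬ |(π i : ℤ) - (i : ℤ)| < t, q ^ mallowsInv π := by
    by_cases hup : (i : ℕ) + 3 * t ≤ n + 1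
    · refine pow_mul_sum_le_sum_of_move hq0 hq1 i _ (fun v => |(v : ℤ) - (i : ℤ)| < t)
        (fun v hv => ⟨v + (2 * t - 1), ?_⟩) ?_ ?_ ?_
      · rw [abs_lt] at hv
        omega
      · exact fun v hv => Or.inl rfl
      · intro v hv
        rw [abs_lt] at hv ⊢
        simp only
        omega
      · intro v hv w hw h
        simp only [Fin.ext_iff] at h ⊢
        omega
    · refine pow_mul_sum_le_sum_of_move hq0 hq1 i _ (fun v => |(v : ℤ) - (i : ℤ)| < t)
        (fun v hv => ⟨v - (2 * t - 1), ?_⟩) ?_ ?_ ?_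
      · have := v.isLt
        omega
      · intro v hv
        rw [abs_lt] at hv
        simp only
        omega
      · intro v hv
        rw [abs_lt] at hv ⊢
        simp only
        omega
      · intro v hv w hw h
        rw [abs_lt] at hv hw
        simp only [Fin.ext_iff] at h ⊢
        omega
  have htotal := Finset.sum_filter_add_sum_filter_not Finset.univ
    (fun π : Equiv.Perm (Fin n) => |(π i : ℤ) - (i : ℤ)| < t) (fun π => q ^ mallowsInv π)
  have hprob : mallowsProb n q {π | (t : ℤ) ≤ |(π i : ℤ) - (i : ℤ)|} =
      (∑ π : Equiv.Perm (Fin n) with ¬ |(π i : ℤ) - (i : ℤ)| < t, q ^ mallowsInv π) /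
        ∑ σ : Equiv.Perm (Fin n), q ^ mallowsInv σ := by
    simp only [mallowsProb, mallowsPMF, Set.indicator_apply, Set.mem_ofPred_eq, not_lt,
      Finset.sum_div, Finset.sum_filter, ite_div, zero_div]
  have hZ : 0 < ∑ σ : Equiv.Perm (Fin n), q ^ mallowsInv σ :=
    Finset.sum_pos (fun _ _ => pow_pos hq0 _) Finset.univ_nonempty
  have hpow : q ^ (2 * t - 1) ≤ 1 := pow_le_one₀ hq0.le hq1.le
  have hnonneg : 0 ≤ ∑ π : Equiv.Perm (Fin n) with ¬ |(π i : ℤ) - (i : ℤ)| < t,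
      q ^ mallowsInv π := Finset.sum_nonneg fun _ _ => pow_nonneg hq0.le _
  rw [hprob, le_div_iff₀ hZ, ← htotal]
  nlinarith [mul_le_mul_of_nonneg_right hpow hnonneg]
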